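/- Let n ∈ ℕ, let Q ∈ [0,1]^{n×n} be a symmetric matrix with zero diagonal, let d ≥ 5 satisfy Q_ij ≤ d/n for all i,j, let d° := d(Q) = (1/n)·Σ_{i,j} Q_ij, and let δ ∈ (0,1). Then with probability at least 1 − n^{1−d/4} − exp(−δ²·n·d°/6), a random graph A drawn from G(n,Q) has the following property: for every t ∈ [2e², log n] there exists an n-node graph Ã with Ã_ij ≤ A_ij entrywise such that every node of Ã has degree at most t·d, and (1−δ)·d° − 4·t·e^{−t}·d ≤ d(Ã) ≤ (1+δ)·d°. -/

import Mathlib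

open scoped BigOperators Classical

namespace EdgeDensity

/-- A graph on `n` nodes, identified with its Boolean adjacency function:
symmetric with no self-loops. -/
def IsGraph {n : ℕ} (A : Fin n → Fin n → Bool) : Prop :=
  (∀ i j, A i j = A j i) ∧ ∀ i, A i i = false

/-- The real adjacency matrix of a Boolean graph. -/
def adjMat {n : ℕ} (A : Fin n → Fin n → Bool) : Matrix (Fin n) (Fin n) ℝ :=
  Matrix.of fun i j => if A i j then 1 else 0

/-- `d(M) = (1/n) ∑_{i,j} M i j`, the average row sum. -/
noncomputable def dbar {n : ℕ} (M : Matrix (Fin n) (Fin n) ℝ) : ℝ :=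
  (∑ i, ∑ j, M i j) / n

/-- `(M 𝟙)_i = ∑_j M i j`, the `i`-th row sum (degree of node `i`). -/
def rowSum {n : ℕ} (M : Matrix (Fin n) (Fin n) ℝ) (i : Fin n) : ℝ := ∑ j, M i j

/-- The probability that the inhomogeneous random graph `G(n,Q)` equals the
given graph `A`: each edge `{i,j}` with `i < j` is present independently with
probability `Q i j`. -/
noncomputable def erWeight {n : ℕ} (Q : Matrix (Fin n) (Fin n) ℝ)
    (A : Fin n → Fin n → Bool) : ℝ :=
  ∏ i, ∏ j ∈ Finset.univ.filter (fun j => i < j),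
    (if A i j then Q i j else 1 - Q i j)

/-- Probability of the event `E` under the inhomogeneous random graph `G(n,Q)`. -/
noncomputable def erProb {n : ℕ} (Q : Matrix (Fin n) (Fin n) ℝ)
    (E : (Fin n → Fin n → Bool) → Prop) : ℝ :=
  ∑ A ∈ Finset.univ.filter (fun A => IsGraph A ∧ E A), erWeight Q A

/-- Node distance between two graphs: the minimum cardinality of a set `S` of
nodes such that the two adjacency matrices agree on all entries `(i,j)` with
`i ∉ S` and `j ∉ S`. -/
noncomputable def nodeDist {n : ℕ} (A B : Fin n → Fin n → Bool) : ℕ :=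
  sInf {k | ∃ S : Finset (Fin n), S.card = k ∧
    ∀ i j, i ∉ S → j ∉ S → A i j = B i j}

/-- The feasibility constraints `P1(A, γ)` on a pair `(Y, z)`. -/
def P1 {n : ℕ} (A : Matrix (Fin n) (Fin n) ℝ) (γ : ℝ)
    (Y : Matrix (Fin n) (Fin n) ℝ) (z : Fin n → ℝ) : Prop :=
  (∀ i, z i = 0 ∨ z i = 1) ∧
  ((1 - γ) * n ≤ ∑ i, z i) ∧
  (∀ i j, Y i j = Y j i) ∧
  (∀ i j, 0 ≤ Y i j ∧ Y i j ≤ 1) ∧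
  (∀ i j, Y i j * z i * z j = A i j * z i * z j)

/-- The binomial probability mass function `Bin(n,p)` at `k`. -/
noncomputable def binomPMF (n : ℕ) (p : ℝ) (k : ℕ) : ℝ :=
  (n.choose k : ℝ) * p ^ k * (1 - p) ^ (n - k)

/-- Total variation distance between `Bin(n,p)` and `Bin(n,q)`. -/
noncomputable def binomTV (n : ℕ) (p q : ℝ) : ℝ :=
  (∑ k ∈ Finset.range (n + 1), |binomPMF n p k - binomPMF n q k|) / 2

/-- The spectral norm (largest singular value) of a real square matrix. -/
noncomputable def specNorm {n : ℕ} (M : Matrix (Fin n) (Fin n) ℝ) : ℝ :=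
  ‖LinearMap.toContinuousLinearMap (Matrix.toEuclideanLin M)‖

/-- A randomized algorithm on `n`-node graphs is `ε`-differentially
node-private. -/
def IsNodeDP {n : ℕ} (ε : ℝ)
    (𝒜 : (Fin n → Fin n → Bool) → MeasureTheory.Measure ℝ) : Prop :=
  ∀ G G', IsGraph G → IsGraph G' → nodeDist G G' ≤ 1 →
    ∀ S : Set ℝ, MeasurableSet S →
      𝒜 G S ≤ ENNReal.ofReal (Real.exp ε) * 𝒜 G' S

/-- `Pr_{G ~ G(n,Q), 𝒜}[𝒜(G) ∈ S]`. -/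
noncomputable def algProb {n : ℕ} (Q : Matrix (Fin n) (Fin n) ℝ)
    (𝒜 : (Fin n → Fin n → Bool) → MeasureTheory.Measure ℝ) (S : Set ℝ) : ℝ :=
  ∑ A ∈ Finset.univ.filter (fun A => IsGraph A), erWeight Q A * (𝒜 A S).toReal


section Auxiliary

variable {n : ℕ}

/-- A product over ordered pairs is a product over the subtype of ordered pairs. -/
lemma prod_pairs_eq (F : Fin n → Fin n → ℝ) :
    ∏ i, ∏ j ∈ Finset.univ.filter (fun j => i < j), F i j =
      ∏ p : {p : Fin n × Fin n // p.1 < p.2}, F p.1.1 p.1.2 := by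
  rw [← Finset.prod_subtype (Finset.univ.filter fun p : Fin n × Fin n => p.1 < p.2)
    (by simp) (fun p => F p.1 p.2), Finset.prod_filter, Fintype.prod_prod_type]
  simp only [Finset.prod_filter]

lemma sum_graph_prod (f : Fin n → Fin n → Bool → ℝ) :
    ∑ A ∈ Finset.univ.filter (fun A : Fin n → Fin n → Bool => IsGraph A),
        ∏ i, ∏ j ∈ Finset.univ.filter (fun j => i < j), f i j (A i j) =
      ∏ i, ∏ j ∈ Finset.univ.filter (fun j => i < j), (f i j true + f i j false) := by
  have h : ∀ p : {p : Fin n × Fin n // p.1 < p.2},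
      f p.1.1 p.1.2 true + f p.1.1 p.1.2 false = ∑ b : Bool, f p.1.1 p.1.2 b := by
    intro p
    simp
  rw [prod_pairs_eq]
  simp only [h]
  rw [Finset.prod_univ_sum, Fintype.piFinset_univ]
  refine Finset.sum_bij' (fun A _ p => A p.1.1 p.1.2)
    (fun g _ i j => if h : i < j then g ⟨(i, j), h⟩ else
      if h : j < i then g ⟨(j, i), h⟩ else false) ?_ ?_ ?_ ?_ ?_
  · intro A _
    simp
  · intro g _
    simp only [Finset.mem_filter, Finset.mem_univ, true_and]
    refine ⟨fun i j => ?_, fun i => by simp⟩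
    rcases lt_trichotomy i j with h | h | h
    · simp [h, h.not_gt]
    · simp [h]
    · simp [h, h.not_gt]
  · intro A hA
    simp only [Finset.mem_filter, Finset.mem_univ, true_and] at hA
    funext i j
    rcases lt_trichotomy i j with h | h | h
    · simp [h]
    · simp [h, hA.2]
    · simp [h, h.not_gt, hA.1 i j]
  · intro g _
    funext p
    simp [p.2]
  · intro A _
    rw [prod_pairs_eq (fun i j => f i j (A i j))]

lemma erWeight_nonneg {Q : Matrix (Fin n) (Fin n) ℝ} (hQ : ∀ i j, 0 ≤ Q i j ∧ Q i j ≤ 1)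
    (A : Fin n → Fin n → Bool) : 0 ≤ erWeight Q A := by
  refine Finset.prod_nonneg fun i _ => Finset.prod_nonneg fun j _ => ?_
  split_ifs
  · exact (hQ i j).1
  · linarith [(hQ i j).2]

lemma sum_erWeight (Q : Matrix (Fin n) (Fin n) ℝ) :
    ∑ A ∈ Finset.univ.filter (fun A : Fin n → Fin n → Bool => IsGraph A), erWeight Q A = 1 := by
  have h := sum_graph_prod (fun i j b => if b then Q i j else 1 - Q i j)
  simpa [erWeight] using h

/-- Exponential moment bound for linear statistics of the edges of `G(n,Q)`. -/
lemma exp_moment_le {Q : Matrix (Fin n) (Fin n) ℝ} (hQ : ∀ i j, 0 ≤ Q i j ∧ Q i j ≤ 1)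
    (c : Fin n → Fin n → ℝ) :
    ∑ A ∈ Finset.univ.filter (fun A : Fin n → Fin n → Bool => IsGraph A),
        erWeight Q A * Real.exp (∑ i, ∑ j ∈ Finset.univ.filter (fun j => i < j),
          c i j * adjMat A i j) ≤
      Real.exp (∑ i, ∑ j ∈ Finset.univ.filter (fun j => i < j),
        Q i j * (Real.exp (c i j) - 1)) := by
  have h := sum_graph_prod (fun i j b =>
    (if b then Q i j else 1 - Q i j) * Real.exp (c i j * if b then 1 else 0))
  have h' : ∀ A : Fin n → Fin n → Bool,
      erWeight Q A * Real.exp (∑ i, ∑ j ∈ Finset.univ.filter (fun j => i < j),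
          c i j * adjMat A i j) =
        ∏ i, ∏ j ∈ Finset.univ.filter (fun j => i < j),
          (if A i j then Q i j else 1 - Q i j) * Real.exp (c i j * if A i j then 1 else 0) := by
    intro A
    simp only [Finset.prod_mul_distrib, Real.exp_sum, erWeight, adjMat, Matrix.of_apply]
  simp only [h']
  rw [h]
  simp only [Real.exp_sum]
  refine Finset.prod_le_prod (fun i _ => Finset.prod_nonneg fun j _ => ?_)
    fun i _ => Finset.prod_le_prod (fun j _ => ?_) fun j _ => ?_
  · have := (hQ i j).1
    have h2 : 0 ≤ 1 - Q i j := by linarith [(hQ i j).2]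
    simp only [if_true]
    positivity
  · have := (hQ i j).1
    have h2 : 0 ≤ 1 - Q i j := by linarith [(hQ i j).2]
    simp only [if_true]
    positivity
  · have := Real.add_one_le_exp (Q i j * (Real.exp (c i j) - 1))
    simp
    linarith

/-- Summing a matrix with zero diagonal over unordered pairs. -/
lemma sum_eq_sum_lt (F : Fin n → Fin n → ℝ) (hF : ∀ i, F i i = 0) :
    ∑ i, ∑ j, F i j =
      ∑ i, ∑ j ∈ Finset.univ.filter (fun j => i < j), (F i j + F j i) := by
  have h : ∀ i j, F i j = (if i < j then F i j else 0) + (if j < i then F i j else 0) := by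
    intro i j
    rcases lt_trichotomy i j with h | h | h
    · simp [h, h.not_gt]
    · simp [h, hF]
    · simp [h, h.not_gt]
  have h2 : ∑ i, ∑ j, F i j = ∑ i, ∑ j, (if i < j then F i j else 0) +
      ∑ i, ∑ j, (if j < i then F i j else 0) := by
    simp only [← Finset.sum_add_distrib, ← h]
  rw [h2, Finset.sum_comm (f := fun i j => if j < i then F i j else 0)]
  simp only [Finset.sum_filter, ← Finset.sum_add_distrib]
  refine Finset.sum_congr rfl fun i _ => Finset.sum_congr rfl fun j _ => ?_
  split_ifs <;> simp

lemma sum_mem_rowSum (M : Matrix (Fin n) (Fin n) ℝ) (hsym : ∀ i j, M i j = M j i)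
    (hdiag : ∀ i, M i i = 0) (S : Finset (Fin n)) :
    ∑ i ∈ S, rowSum M i =
      ∑ i, ∑ j ∈ Finset.univ.filter (fun j => i < j),
        ((if i ∈ S then 1 else 0) + (if j ∈ S then 1 else 0)) * M i j := by
  have h : ∑ i ∈ S, rowSum M i = ∑ i, ∑ j, (if i ∈ S then 1 else 0) * M i j := by
    simp [rowSum]
  rw [h, sum_eq_sum_lt _ (by simp [hdiag])]
  refine Finset.sum_congr rfl fun i _ => Finset.sum_congr rfl fun j _ => ?_
  rw [hsym j i]
  ring

lemma adjMat_symm {A : Fin n → Fin n → Bool} (hA : IsGraph A) (i j : Fin n) :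
    adjMat A i j = adjMat A j i := by
  simp [adjMat, hA.1 i j]

lemma adjMat_diag {A : Fin n → Fin n → Bool} (hA : IsGraph A) (i : Fin n) :
    adjMat A i i = 0 := by
  simp [adjMat, hA.2 i]

lemma adjMat_nonneg (A : Fin n → Fin n → Bool) (i j : Fin n) : 0 ≤ adjMat A i j := by
  simp only [adjMat, Matrix.of_apply]
  split_ifs <;> norm_num

lemma adjMat_mono {A B : Fin n → Fin n → Bool} (h : ∀ i j, B i j = true → A i j = true)
    (i j : Fin n) : adjMat B i j ≤ adjMat A i j := by
  have := h i j
  simp only [adjMat, Matrix.of_apply]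
  split_ifs <;> simp_all

/-- Exponential moment of the total degree of a node set. -/
lemma exp_moment_degree_le {Q : Matrix (Fin n) (Fin n) ℝ} (hsym : ∀ i j, Q i j = Q j i)
    (hdiag : ∀ i, Q i i = 0) (hQ : ∀ i j, 0 ≤ Q i j ∧ Q i j ≤ 1) {d : ℝ}
    (hQd : ∀ i j, Q i j ≤ d / n) (hn : 0 < n) (S : Finset (Fin n)) :
    ∑ A ∈ Finset.univ.filter (fun A : Fin n → Fin n → Bool => IsGraph A),
        erWeight Q A * Real.exp (∑ i ∈ S, rowSum (adjMat A) i) ≤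
      Real.exp (Real.exp 2 * (S.card * d)) := by
  have h1 := exp_moment_le hQ
    (fun i j => (if i ∈ S then 1 else 0) + (if j ∈ S then 1 else 0))
  have h2 : ∑ A ∈ Finset.univ.filter (fun A : Fin n → Fin n → Bool => IsGraph A),
        erWeight Q A * Real.exp (∑ i ∈ S, rowSum (adjMat A) i) =
      ∑ A ∈ Finset.univ.filter (fun A : Fin n → Fin n → Bool => IsGraph A),
        erWeight Q A * Real.exp (∑ i, ∑ j ∈ Finset.univ.filter (fun j => i < j),
          ((if i ∈ S then 1 else 0) + (if j ∈ S then 1 else 0)) * adjMat A i j) := by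
    refine Finset.sum_congr rfl fun A hA => ?_
    have hA' : IsGraph A := by simpa using hA
    rw [sum_mem_rowSum _ (adjMat_symm hA') (adjMat_diag hA')]
  rw [h2]
  refine h1.trans (Real.exp_le_exp.2 ?_)
  have h3 : ∑ i ∈ S, rowSum Q i ≤ S.card * d := by
    rw [← nsmul_eq_mul]
    refine Finset.sum_le_card_nsmul _ _ _ fun i _ => ?_
    calc rowSum Q i ≤ ∑ _j : Fin n, d / n := Finset.sum_le_sum fun j _ => hQd i j
      _ = d := by
        have : (n : ℝ) ≠ 0 := by positivity
        simp
        field_simp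
  refine le_trans ?_ (mul_le_mul_of_nonneg_left h3 (Real.exp_pos 2).le)
  rw [sum_mem_rowSum Q hsym hdiag, Finset.mul_sum]
  refine Finset.sum_le_sum fun i _ => ?_
  rw [Finset.mul_sum]
  refine Finset.sum_le_sum fun j _ => ?_
  have hq := (hQ i j).1
  have he : Real.exp 1 ≤ Real.exp 2 := Real.exp_le_exp.2 (by norm_num)
  have he2 := Real.exp_pos 2
  have key : ∀ c : ℝ, Real.exp c - 1 ≤ Real.exp 2 * c →
      Q i j * (Real.exp c - 1) ≤ Real.exp 2 * (c * Q i j) := fun c hc => by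
    nlinarith [mul_le_mul_of_nonneg_left hc hq]
  apply key
  split_ifs
  · norm_num
    linarith
  · norm_num
    linarith
  · norm_num
    linarith
  · simp

lemma exp_neg_le_quadratic {x : ℝ} (hx : 0 ≤ x) : Real.exp (-x) ≤ 1 - x + x ^ 2 / 2 := by
  rw [Real.exp_neg]
  have h := Real.quadratic_le_exp_of_nonneg hx
  have hpos : 0 < 1 + x + x ^ 2 / 2 := by positivity
  refine (inv_anti₀ hpos h).trans ?_
  rw [inv_le_iff_one_le_mul₀ hpos]
  nlinarith [sq_nonneg (x ^ 2)]

lemma mul_dbar (hn : 0 < n) (M : Matrix (Fin n) (Fin n) ℝ) :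
    n * dbar M = ∑ i, ∑ j, M i j := by
  have : (n : ℝ) ≠ 0 := by positivity
  simp only [dbar]
  field_simp

/-- Exponential moment controlling the lower tail of the number of edges. -/
lemma exp_moment_edges_le {Q : Matrix (Fin n) (Fin n) ℝ} (hsym : ∀ i j, Q i j = Q j i)
    (hdiag : ∀ i, Q i i = 0) (hQ : ∀ i j, 0 ≤ Q i j ∧ Q i j ≤ 1) (hn : 0 < n)
    {δ : ℝ} (hδ : 0 ≤ δ) :
    ∑ A ∈ Finset.univ.filter (fun A : Fin n → Fin n → Bool => IsGraph A),
        erWeight Q A * Real.exp (δ * n * ((1 - δ) * dbar Q - dbar (adjMat A)) / 2) ≤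
      Real.exp (-(δ ^ 2 * n * dbar Q) / 6) := by
  have hpair : ∀ M : Matrix (Fin n) (Fin n) ℝ, (∀ i j, M i j = M j i) → (∀ i, M i i = 0) →
      n * dbar M / 2 = ∑ i, ∑ j ∈ Finset.univ.filter (fun j => i < j), M i j := by
    intro M hs hd
    rw [mul_dbar hn, sum_eq_sum_lt _ hd]
    simp only [← hs, ← two_mul, ← Finset.mul_sum]
    ring
  have h1 := exp_moment_le hQ (fun _ _ => -δ)
  have h2 : ∑ A ∈ Finset.univ.filter (fun A : Fin n → Fin n → Bool => IsGraph A),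
        erWeight Q A * Real.exp (δ * n * ((1 - δ) * dbar Q - dbar (adjMat A)) / 2) =
      Real.exp (δ * (1 - δ) * (n * dbar Q / 2)) *
      ∑ A ∈ Finset.univ.filter (fun A : Fin n → Fin n → Bool => IsGraph A),
        erWeight Q A * Real.exp (∑ i, ∑ j ∈ Finset.univ.filter (fun j => i < j),
          -δ * adjMat A i j) := by
    rw [Finset.mul_sum]
    refine Finset.sum_congr rfl fun A hA => ?_
    have hA' : IsGraph A := by simpa using hA
    simp only [← Finset.mul_sum]
    rw [← hpair _ (adjMat_symm hA') (adjMat_diag hA'), mul_left_comm, ← Real.exp_add]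
    congr 2
    ring
  rw [h2]
  refine (mul_le_mul_of_nonneg_left h1 (Real.exp_pos _).le).trans ?_
  simp only [← Finset.sum_mul]
  rw [← hpair Q hsym hdiag, ← Real.exp_add]
  refine Real.exp_le_exp.2 ?_
  have hQ0 : 0 ≤ n * dbar Q := by
    rw [mul_dbar hn]
    exact Finset.sum_nonneg fun i _ => Finset.sum_nonneg fun j _ => (hQ i j).1
  have h3 := mul_le_mul_of_nonneg_left (exp_neg_le_quadratic hδ) hQ0
  nlinarith [mul_nonneg (sq_nonneg δ) hQ0]

lemma exists_subgraph_dbar {B : Fin n → Fin n → Bool} (hB : IsGraph B) {L c : ℝ}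
    (hc : 0 ≤ c) (hL : L ≤ dbar (adjMat B)) (hLc : L ≤ c - 2 / n) :
    ∃ B' : Fin n → Fin n → Bool, IsGraph B' ∧ (∀ i j, B' i j = true → B i j = true) ∧
      L ≤ dbar (adjMat B') ∧ dbar (adjMat B') ≤ c := by
  obtain ⟨C, hC, hmin⟩ := Finset.exists_min_image
    (Finset.univ.filter fun C : Fin n → Fin n → Bool =>
      IsGraph C ∧ (∀ i j, C i j = true → B i j = true) ∧ L ≤ dbar (adjMat C))
    (fun C => dbar (adjMat C)) ⟨B, by simp [hB, hL]⟩
  simp only [Finset.mem_filter, Finset.mem_univ, true_and] at hC hmin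
  refine ⟨C, hC.1, hC.2.1, hC.2.2, ?_⟩
  by_contra! hlt
  have hedge : ∃ a b, C a b = true := by
    by_contra! h
    have : dbar (adjMat C) = 0 := by simp [dbar, adjMat, h]
    linarith
  obtain ⟨a, b, hab⟩ := hedge
  have hne : a ≠ b := by
    rintro rfl
    simp [hC.1.2] at hab
  have hn : 0 < n := a.pos
  have hba : C b a = true := by rw [hC.1.1, hab]
  let D : Fin n → Fin n → Bool := fun i j =>
    C i j && !decide ((i = a ∧ j = b) ∨ (i = b ∧ j = a))
  have hD : IsGraph D := by
    refine ⟨fun i j => ?_, fun i => by simp [D, hC.1.2]⟩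
    simp only [D]
    rw [hC.1.1 i j]
    congr 2
    apply decide_eq_decide.2
    tauto
  have hadj : ∀ i j, adjMat D i j = adjMat C i j -
      (if i = a then (if j = b then 1 else 0) else 0) -
      (if i = b then (if j = a then 1 else 0) else 0) := by
    intro i j
    simp only [adjMat, D, Matrix.of_apply]
    by_cases h1 : i = a <;> by_cases h2 : j = b <;> by_cases h3 : i = b <;>
      by_cases h4 : j = a <;> simp_all
  have hdb : dbar (adjMat D) = dbar (adjMat C) - 2 / n := by
    simp only [dbar, hadj, Finset.sum_sub_distrib]
    simp
    ring
  have hpos : (0 : ℝ) < 2 / n := by positivity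
  have := hmin D ⟨hD, fun i j h => hC.2.1 i j (by simp only [D, Bool.and_eq_true] at h; exact h.1),
    by rw [hdb]; linarith⟩
  linarith

/-- The threshold, in units of `d`, such that with high probability every set of `k` nodes has
average degree at most this. -/
noncomputable def threshold (n k : ℕ) : ℝ := max (2 * Real.exp 2) (Real.log (n / k))

lemma mul_exp_neg_anti {t u : ℝ} (ht : 1 ≤ t) (htu : t ≤ u) :
    u * Real.exp (-u) ≤ t * Real.exp (-t) := by
  have h1 := Real.add_one_le_exp (u - t)
  have h2 : u ≤ t * Real.exp (u - t) := by nlinarith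
  calc u * Real.exp (-u) ≤ t * Real.exp (u - t) * Real.exp (-u) := by gcongr
    _ = t * Real.exp (-t) := by
      rw [mul_assoc, ← Real.exp_add]
      congr 2
      ring

lemma five_le_exp_two : (5 : ℝ) ≤ Real.exp 2 := by
  have := Real.quadratic_le_exp_of_nonneg (show (0 : ℝ) ≤ 2 by norm_num)
  norm_num at this
  exact this

/-- Deterministic truncation: if no node set has abnormally large total degree, then
truncating and pruning gives a bounded-degree subgraph of the right density. -/
lemma exists_truncation {A : Fin n → Fin n → Bool} (hA : IsGraph A) {d δ q t : ℝ}
    (hd : 5 ≤ d) (hδ : 0 ≤ δ) (hq : 0 ≤ q) (hn : 0 < n)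
    (hlow : (1 - δ) * q ≤ dbar (adjMat A))
    (hdeg : ∀ S : Finset (Fin n), S.Nonempty →
      ∑ i ∈ S, rowSum (adjMat A) i ≤ S.card * d * threshold n S.card)
    (ht : 2 * Real.exp 2 ≤ t) (htn : t ≤ Real.log n) :
    ∃ At : Fin n → Fin n → Bool, IsGraph At ∧
      (∀ i j, At i j = true → A i j = true) ∧
      (∀ i, rowSum (adjMat At) i ≤ t * d) ∧
      (1 - δ) * q - 4 * t * Real.exp (-t) * d ≤ dbar (adjMat At) ∧
      dbar (adjMat At) ≤ (1 + δ) * q := by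
  have he := five_le_exp_two
  have hn0 : (0 : ℝ) < n := by positivity
  have hte := Real.exp_pos (-t)
  let S : Finset (Fin n) := Finset.univ.filter fun i => t * d < rowSum (adjMat A) i
  have hS : ∑ i ∈ S, rowSum (adjMat A) i ≤ n * (t * Real.exp (-t) * d) := by
    rcases S.eq_empty_or_nonempty with h | h
    · rw [h]
      simp only [Finset.sum_empty]
      have : 0 ≤ t := by linarith
      have : 0 ≤ d := by linarith
      positivity
    · have h1 := hdeg S h
      have hk : (0 : ℝ) < S.card := by exact_mod_cast h.card_pos
      have h2 : S.card * (t * d) < ∑ i ∈ S, rowSum (adjMat A) i := by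
        rw [← nsmul_eq_mul, ← Finset.sum_const]
        refine Finset.sum_lt_sum_of_nonempty h fun i hi => ?_
        simpa [S] using hi
      have h3 : t < threshold n S.card := by
        have h4 : (S.card * d) * t < (S.card * d) * threshold n S.card := by linarith
        exact lt_of_mul_lt_mul_left h4 (by positivity)
      have h5 : threshold n S.card = Real.log (n / S.card) := by
        rcases max_choice (2 * Real.exp 2) (Real.log (n / S.card)) with h | h
        · rw [threshold, h] at h3
          linarith
        · exact h
      have h6 := mul_exp_neg_anti (by linarith) h3.le
      have h7 : Real.exp (-threshold n S.card) = S.card / n := by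
        rw [h5, Real.exp_neg, Real.exp_log (by positivity), inv_div]
      rw [h7] at h6
      calc _ ≤ _ := h1
        _ = n * (threshold n S.card * (S.card / n) * d) := by field_simp
        _ ≤ _ := by gcongr
  let B : Fin n → Fin n → Bool := fun i j => A i j && !decide (i ∈ S) && !decide (j ∈ S)
  have hB : IsGraph B := by
    refine ⟨fun i j => ?_, fun i => by simp [B, hA.2]⟩
    simp only [B]
    rw [hA.1 i j, Bool.and_right_comm]
  have hBA : ∀ i j, B i j = true → A i j = true := fun i j h => by
    simp only [B, Bool.and_eq_true] at h
    exact h.1.1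
  have hBdeg : ∀ i, rowSum (adjMat B) i ≤ t * d := by
    intro i
    by_cases hi : i ∈ S
    · have : rowSum (adjMat B) i = 0 := by simp [rowSum, adjMat, B, hi]
      rw [this]
      nlinarith
    · refine (Finset.sum_le_sum fun j _ => adjMat_mono hBA i j).trans ?_
      by_contra! hlt
      exact hi (Finset.mem_filter.2 ⟨Finset.mem_univ i, hlt⟩)
  have hBadj : ∀ i j, adjMat A i j ≤ adjMat B i j + (if i ∈ S then adjMat A i j else 0) +
      (if j ∈ S then adjMat A j i else 0) := by
    intro i j
    have h0 := adjMat_nonneg A i j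
    have hAB : i ∉ S → j ∉ S → adjMat B i j = adjMat A i j := fun h1 h2 => by
      simp [adjMat, B, h1, h2]
    have hB0 := adjMat_nonneg B i j
    rw [adjMat_symm hA j i]
    split_ifs with h1 h2 h2
    · linarith
    · linarith
    · linarith
    · linarith [hAB h1 h2]
  have hrow : ∑ i, ∑ j, (if i ∈ S then adjMat A i j else 0) = ∑ i ∈ S, rowSum (adjMat A) i := by
    calc _ = ∑ i, if i ∈ S then rowSum (adjMat A) i else 0 := by
          refine Finset.sum_congr rfl fun i _ => ?_
          split_ifs <;> simp [rowSum]
      _ = _ := by simp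
  have hBd : dbar (adjMat A) ≤ dbar (adjMat B) + 2 * (t * Real.exp (-t) * d) := by
    have h1 : ∑ i, ∑ j, adjMat A i j ≤ ∑ i, ∑ j, adjMat B i j +
        ∑ i ∈ S, rowSum (adjMat A) i + ∑ i ∈ S, rowSum (adjMat A) i := by
      refine (Finset.sum_le_sum fun i _ => Finset.sum_le_sum fun j _ => hBadj i j).trans ?_
      simp only [Finset.sum_add_distrib]
      rw [Finset.sum_comm (f := fun i j => if j ∈ S then adjMat A j i else 0)]
      rw [hrow]
    rw [← mul_dbar hn, ← mul_dbar hn] at h1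
    refine le_of_mul_le_mul_left ?_ hn0
    linarith
  have hexp : 1 / (n : ℝ) ≤ Real.exp (-t) := by
    rw [Real.exp_neg, ← one_div]
    refine one_div_le_one_div_of_le (Real.exp_pos t) ?_
    rw [← Real.exp_log hn0]
    exact Real.exp_le_exp.2 htn
  have htd : 1 ≤ t * d := by nlinarith
  have hslack : Real.exp (-t) ≤ t * Real.exp (-t) * d := by nlinarith
  obtain ⟨C, hC, hCB, hCl, hCu⟩ := exists_subgraph_dbar hB
    (L := (1 - δ) * q - 4 * t * Real.exp (-t) * d) (c := (1 + δ) * q)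
    (by positivity) (by nlinarith)
    (by
      have : 2 / (n : ℝ) = 2 * (1 / n) := by ring
      nlinarith [mul_nonneg hδ hq])
  exact ⟨C, hC, fun i j h => hBA i j (hCB i j h),
    fun i => (Finset.sum_le_sum fun j _ => adjMat_mono hCB i j).trans (hBdeg i), hCl, hCu⟩

lemma choose_le_exp_mul_pow {k : ℕ} (hk : 0 < k) :
    (n.choose k : ℝ) ≤ Real.exp k * (n / k) ^ k := by
  have hk0 : (0 : ℝ) < k := by positivity
  have h1 := Nat.choose_le_pow_div (α := ℝ) k n
  have h2 := Real.pow_div_factorial_le_exp (k : ℝ) hk0.le k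
  refine h1.trans ?_
  have h3 : (n : ℝ) ^ k / k.factorial = (k : ℝ) ^ k / k.factorial * (n / k) ^ k := by
    rw [div_pow]
    field_simp
  rw [h3]
  gcongr

/-- The union bound over all sets of `k` nodes. -/
lemma choose_mul_exp_le {k : ℕ} (hk : 0 < k) (hkn : k ≤ n) {d : ℝ} (hd : 5 ≤ d) :
    n.choose k * Real.exp (Real.exp 2 * (k * d) - k * d * threshold n k) ≤
      (n : ℝ) ^ (-(d / 4)) := by
  have hk0 : (1 : ℝ) ≤ k := by exact_mod_cast hk
  have hn0 : (0 : ℝ) < n := by exact_mod_cast hk.trans_le hkn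
  have he := five_le_exp_two
  set s := threshold n k with hs
  have hs1 : 2 * Real.exp 2 ≤ s := le_max_left _ _
  have hs2 : Real.log (n / k) ≤ s := le_max_right _ _
  have hks : Real.log n ≤ k * s := by
    have h1 : Real.log n = Real.log (n / k) + Real.log k := by
      rw [Real.log_div (by positivity) (by positivity)]
      ring
    have h2 := Real.log_le_sub_one_of_pos (show (0 : ℝ) < k by linarith)
    nlinarith
  have h1 : (n.choose k : ℝ) ≤ Real.exp (k + k * s) := by
    refine (choose_le_exp_mul_pow hk).trans ?_
    rw [Real.exp_add, Real.exp_nat_mul s]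
    gcongr
    calc (n : ℝ) / k = Real.exp (Real.log (n / k)) := (Real.exp_log (by positivity)).symm
      _ ≤ Real.exp s := Real.exp_le_exp.2 hs2
  calc _ ≤ Real.exp (k + k * s) * Real.exp (Real.exp 2 * (k * d) - k * d * s) := by gcongr
    _ = Real.exp (k + k * s + (Real.exp 2 * (k * d) - k * d * s)) := (Real.exp_add _ _).symm
    _ ≤ Real.exp (Real.log n * (-(d / 4))) := by
      refine Real.exp_le_exp.2 ?_
      have hkd : 0 ≤ (k : ℝ) * d := by positivity
      have h2 : Real.exp 2 * (k * d) ≤ k * d * s / 2 := by nlinarith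
      have h3 : (k : ℝ) ≤ k * s / 10 := by nlinarith
      have h4 : Real.log n * (d / 4) ≤ k * s * (d / 4) := by gcongr
      have h5 : 0 ≤ (k * s) * (d - 5) := by
        have : 0 ≤ d - 5 := by linarith
        have : 0 ≤ s := by linarith
        positivity
      have h6 : 0 ≤ k * s := by nlinarith
      linarith
    _ = _ := by rw [Real.rpow_def_of_pos hn0]

lemma sum_nonempty_exp_le (hn : 0 < n) {d : ℝ} (hd : 5 ≤ d) :
    ∑ S ∈ Finset.univ.filter (fun S : Finset (Fin n) => S.Nonempty),
      Real.exp (Real.exp 2 * (S.card * d) - S.card * d * threshold n S.card) ≤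
      (n : ℝ) ^ (1 - d / 4) := by
  have hn0 : (0 : ℝ) < n := by positivity
  have h1 : ∀ S ∈ Finset.univ.filter (fun S : Finset (Fin n) => S.Nonempty),
      S.card ∈ Finset.Icc 1 n := by
    intro S hS
    simp only [Finset.mem_filter, Finset.mem_univ, true_and] at hS
    have := S.card_le_univ
    simp only [Fintype.card_fin] at this
    exact Finset.mem_Icc.2 ⟨hS.card_pos, this⟩
  rw [← Finset.sum_fiberwise_of_maps_to h1]
  calc _ ≤ ∑ k ∈ Finset.Icc 1 n, (n : ℝ) ^ (-(d / 4)) := by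
        refine Finset.sum_le_sum fun k hk => ?_
        rw [Finset.mem_Icc] at hk
        refine le_trans (le_of_eq ?_) (choose_mul_exp_le hk.1 hk.2 hd)
        have h2 : (Finset.univ.filter (fun S : Finset (Fin n) => S.Nonempty)).filter
            (fun S => S.card = k) = Finset.powersetCard k Finset.univ := by
          ext S
          simp only [Finset.mem_filter, Finset.mem_univ, true_and, Finset.mem_powersetCard,
            Finset.subset_univ, and_iff_right_iff_imp]
          intro h
          exact Finset.card_pos.1 (by lia)
        rw [h2, Finset.sum_congr rfl (g := fun _ =>
          Real.exp (Real.exp 2 * (k * d) - k * d * threshold n k))]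
        · simp
        · intro S hS
          rw [(Finset.mem_powersetCard.1 hS).2]
    _ = (n : ℝ) ^ (1 - d / 4) := by
        rw [sub_eq_add_neg, Real.rpow_add hn0, Real.rpow_one]
        simp

lemma erProb_nonneg {Q : Matrix (Fin n) (Fin n) ℝ} (hQ : ∀ i j, 0 ≤ Q i j ∧ Q i j ≤ 1)
    (E : (Fin n → Fin n → Bool) → Prop) : 0 ≤ erProb Q E :=
  Finset.sum_nonneg fun A _ => erWeight_nonneg hQ A

/-- If the failure of `E` forces `F ≥ 1`, then `E` has probability at least `1 - 𝔼 F`. -/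
lemma one_le_erProb_add {Q : Matrix (Fin n) (Fin n) ℝ} (hQ : ∀ i j, 0 ≤ Q i j ∧ Q i j ≤ 1)
    (E : (Fin n → Fin n → Bool) → Prop) (F : (Fin n → Fin n → Bool) → ℝ)
    (hF : ∀ A, 0 ≤ F A) (h : ∀ A, IsGraph A → ¬ E A → 1 ≤ F A) :
    1 ≤ erProb Q E +
      ∑ A ∈ Finset.univ.filter (fun A : Fin n → Fin n → Bool => IsGraph A),
        erWeight Q A * F A := by
  rw [← sum_erWeight Q, erProb, ← Finset.filter_filter,
    Finset.sum_filter (s := Finset.univ.filter IsGraph), ← Finset.sum_add_distrib]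
  refine Finset.sum_le_sum fun A hA => ?_
  have hw := erWeight_nonneg hQ A
  split_ifs with hE
  · linarith [mul_nonneg hw (hF A)]
  · have := h A (by simpa using hA) hE
    nlinarith

end Auxiliary

/-- degree-truncated subgraphs of inhomogeneous random
graphs. -/
theorem degree_truncated_subgraph (n : ℕ) (Q : Matrix (Fin n) (Fin n) ℝ)
    (hsym : ∀ i j, Q i j = Q j i) (hdiag : ∀ i, Q i i = 0)
    (hrange : ∀ i j, 0 ≤ Q i j ∧ Q i j ≤ 1)
    (d : ℝ) (hd : 5 ≤ d) (hQd : ∀ i j, Q i j ≤ d / n)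
    (δ : ℝ) (hδ0 : 0 < δ) (hδ1 : δ < 1) :
    1 - (n : ℝ) ^ (1 - d / 4) - Real.exp (-(δ ^ 2 * n * dbar Q) / 6) ≤
      erProb Q (fun A => ∀ t : ℝ, 2 * Real.exp 2 ≤ t → t ≤ Real.log n →
        ∃ At : Fin n → Fin n → Bool, IsGraph At ∧
          (∀ i j, At i j = true → A i j = true) ∧
          (∀ i, rowSum (adjMat At) i ≤ t * d) ∧
          (1 - δ) * dbar Q - 4 * t * Real.exp (-t) * d ≤ dbar (adjMat At) ∧
          dbar (adjMat At) ≤ (1 + δ) * dbar Q) := by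
  rcases Nat.eq_zero_or_pos n with rfl | hn
  · have h := erProb_nonneg hrange (fun A => ∀ t : ℝ, 2 * Real.exp 2 ≤ t →
        t ≤ Real.log (0 : ℕ) →
        ∃ At : Fin 0 → Fin 0 → Bool, IsGraph At ∧
          (∀ i j, At i j = true → A i j = true) ∧
          (∀ i, rowSum (adjMat At) i ≤ t * d) ∧
          (1 - δ) * dbar Q - 4 * t * Real.exp (-t) * d ≤ dbar (adjMat At) ∧
          dbar (adjMat At) ≤ (1 + δ) * dbar Q)
    refine le_trans ?_ h
    have : (0 : ℝ) ≤ ((0 : ℕ) : ℝ) ^ (1 - d / 4) := by positivity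
    simp only [Nat.cast_zero, mul_zero, zero_mul, neg_zero, zero_div, Real.exp_zero] at this ⊢
    linarith
  have hq : 0 ≤ dbar Q :=
    div_nonneg (Finset.sum_nonneg fun i _ => Finset.sum_nonneg fun j _ => (hrange i j).1)
      (Nat.cast_nonneg n)
  have key := one_le_erProb_add hrange (fun A => ∀ t : ℝ, 2 * Real.exp 2 ≤ t →
        t ≤ Real.log n →
        ∃ At : Fin n → Fin n → Bool, IsGraph At ∧
          (∀ i j, At i j = true → A i j = true) ∧
          (∀ i, rowSum (adjMat At) i ≤ t * d) ∧
          (1 - δ) * dbar Q - 4 * t * Real.exp (-t) * d ≤ dbar (adjMat At) ∧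
          dbar (adjMat At) ≤ (1 + δ) * dbar Q)
    (fun A => ∑ S ∈ Finset.univ.filter (fun S : Finset (Fin n) => S.Nonempty),
        Real.exp (∑ i ∈ S, rowSum (adjMat A) i) *
          Real.exp (-(S.card * d * threshold n S.card)) +
      Real.exp (δ * n * ((1 - δ) * dbar Q - dbar (adjMat A)) / 2))
    (fun A => by positivity) (fun A hA hE => by
      by_cases hlow : (1 - δ) * dbar Q ≤ dbar (adjMat A)
      · have hex : ∃ S : Finset (Fin n), S.Nonempty ∧
            S.card * d * threshold n S.card < ∑ i ∈ S, rowSum (adjMat A) i := by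
          by_contra! hdeg
          exact hE fun t ht htn => exists_truncation hA hd hδ0.le hq hn hlow hdeg ht htn
        obtain ⟨S, hS, hlt⟩ := hex
        have h1 := Finset.single_le_sum
          (f := fun S : Finset (Fin n) => Real.exp (∑ i ∈ S, rowSum (adjMat A) i) *
            Real.exp (-(S.card * d * threshold n S.card)))
          (fun S _ => by positivity)
          (show S ∈ Finset.univ.filter (fun S : Finset (Fin n) => S.Nonempty) by simpa using hS)
        have h2 : 1 ≤ Real.exp (∑ i ∈ S, rowSum (adjMat A) i) *
            Real.exp (-(S.card * d * threshold n S.card)) := by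
          rw [← Real.exp_add]
          exact Real.one_le_exp (by linarith)
        have h3 := Real.exp_pos (δ * n * ((1 - δ) * dbar Q - dbar (adjMat A)) / 2)
        linarith
      · have h1 : 1 ≤ Real.exp (δ * n * ((1 - δ) * dbar Q - dbar (adjMat A)) / 2) := by
          have : 0 ≤ (1 - δ) * dbar Q - dbar (adjMat A) := by linarith
          exact Real.one_le_exp (by positivity)
        have h2 : 0 ≤ ∑ S ∈ Finset.univ.filter (fun S : Finset (Fin n) => S.Nonempty),
            Real.exp (∑ i ∈ S, rowSum (adjMat A) i) *
              Real.exp (-(S.card * d * threshold n S.card)) := by positivity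
        linarith)
  simp only [mul_add, Finset.sum_add_distrib, Finset.mul_sum] at key
  rw [Finset.sum_comm] at key
  have hedges := exp_moment_edges_le hsym hdiag hrange hn hδ0.le
  have hdegs : ∑ S ∈ Finset.univ.filter (fun S : Finset (Fin n) => S.Nonempty),
      ∑ A ∈ Finset.univ.filter (fun A : Fin n → Fin n → Bool => IsGraph A),
        erWeight Q A * (Real.exp (∑ i ∈ S, rowSum (adjMat A) i) *
          Real.exp (-(S.card * d * threshold n S.card))) ≤ (n : ℝ) ^ (1 - d / 4) := by
    refine le_trans (Finset.sum_le_sum fun S _ => ?_) (sum_nonempty_exp_le hn hd)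
    simp only [← mul_assoc]
    rw [← Finset.sum_mul, sub_eq_add_neg, Real.exp_add]
    simp only [mul_assoc]
    have := exp_moment_degree_le hsym hdiag hrange hQd hn S
    exact mul_le_mul_of_nonneg_right this (Real.exp_pos _).le
  linarith

end EdgeDensity
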